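/- Let T > 0. Let u : [0,T] × ℝ² → ℝ be such that t ↦ u(t,·) is a continuously differentiable map from [0,T] into the Schwartz space 𝒮(ℝ²). Let Ψ : ℝ × ℝ² → ℝ be smooth with Ψ and ∂ₓΨ bounded, set G := ∂ₜΨ + ∂ₓ(∂ₓ² + ∂ᵧ²)Ψ + ½∂ₓ(Ψ²), and assume A := sup_{t∈[0,T]} ‖G(t,·)‖_{L²(ℝ²)} < ∞. Suppose u satisfies the Zakharov–Kuznetsov equation on the background Ψ: ∂ₜu + ∂ₓ(∂ₓ² + ∂ᵧ²)u + ½∂ₓ(u²) + ∂ₓ(uΨ) + G = 0 pointwise on [0,T] × ℝ². Then for all t ∈ [0,T], ‖u(t)‖²_{L²(ℝ²)} ≤ ( ‖u(0)‖²_{L²(ℝ²)} + t·A² ) · exp( (1 + ‖∂ₓΨ‖_{L^∞}) · t ). -/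

import Mathlib

open MeasureTheory

noncomputable section

/-- Partial derivative in the first spatial variable. -/
def pdx (f : ℝ × ℝ → ℝ) (p : ℝ × ℝ) : ℝ := deriv (fun x => f (x, p.2)) p.1

/-- Partial derivative in the second spatial variable. -/
def pdy (f : ℝ × ℝ → ℝ) (p : ℝ × ℝ) : ℝ := deriv (fun y => f (p.1, y)) p.2

/-- The background source term
`G = ∂ₜΨ + ∂ₓ(∂ₓ² + ∂ᵧ²)Ψ + ½∂ₓ(Ψ²)` at time `t`. -/
def bgG (Ψ : ℝ × (ℝ × ℝ) → ℝ) (t : ℝ) (q : ℝ × ℝ) : ℝ :=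
  deriv (fun s => Ψ (s, q)) t +
    pdx (pdx (pdx fun q' => Ψ (t, q'))) q +
    pdx (pdy (pdy fun q' => Ψ (t, q'))) q +
    (1 / 2) * pdx (fun q' => Ψ (t, q') ^ 2) q

open LineDeriv SchwartzMap

theorem pdx_eq_fderiv {f : ℝ × ℝ → ℝ} (hf : Differentiable ℝ f) (p : ℝ × ℝ) :
    pdx f p = fderiv ℝ f p (1, 0) := by
  have h := (hf (p.1, p.2)).hasFDerivAt.comp_hasDerivAt p.1
    ((hasDerivAt_id p.1).prodMk (hasDerivAt_const p.1 p.2))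
  exact h.deriv

theorem pdy_eq_fderiv {f : ℝ × ℝ → ℝ} (hf : Differentiable ℝ f) (p : ℝ × ℝ) :
    pdy f p = fderiv ℝ f p (0, 1) := by
  have h := (hf (p.1, p.2)).hasFDerivAt.comp_hasDerivAt p.2
    ((hasDerivAt_const p.2 p.1).prodMk (hasDerivAt_id p.2))
  exact h.deriv

theorem pdx_schwartz (f : 𝓢(ℝ × ℝ, ℝ)) : pdx f = ⇑(∂_{((1, 0) : ℝ × ℝ)} f : 𝓢(ℝ × ℝ, ℝ)) :=
  funext fun p => pdx_eq_fderiv f.differentiable p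

theorem pdy_schwartz (f : 𝓢(ℝ × ℝ, ℝ)) : pdy f = ⇑(∂_{((0, 1) : ℝ × ℝ)} f : 𝓢(ℝ × ℝ, ℝ)) :=
  funext fun p => pdy_eq_fderiv f.differentiable p

theorem pdx_mul {f g : ℝ × ℝ → ℝ} (hf : Differentiable ℝ f) (hg : Differentiable ℝ g)
    (p : ℝ × ℝ) : pdx (fun q => f q * g q) p = pdx f p * g p + f p * pdx g p := by
  rw [pdx_eq_fderiv (hf.fun_mul hg), pdx_eq_fderiv hf, pdx_eq_fderiv hg,
    fderiv_fun_mul (hf p) (hg p)]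
  simp
  ring

/-- Directional derivatives of a Schwartz function commute. -/
theorem lineDerivOp_comm_schwartz (f : 𝓢(ℝ × ℝ, ℝ)) (v w : ℝ × ℝ) :
    ∂_{v} (∂_{w} f) = ∂_{w} (∂_{v} f) := by
  ext x
  have hd : DifferentiableAt ℝ (fderiv ℝ f) x :=
    ((f.smooth 2).fderiv_right (m := 1) (by norm_num)).differentiable (by norm_num) x
  have key : ∀ a b : ℝ × ℝ, (∂_{a} (∂_{b} f)) x = fderiv ℝ (fderiv ℝ f) x a b := by
    intro a b
    rw [lineDerivOp_apply_eq_fderiv]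
    change fderiv ℝ (fun y => fderiv ℝ f y b) x a = _
    rw [fderiv_clm_apply hd (by fun_prop)]
    simp
  rw [key, key]
  exact ((f.smooth 2).contDiffAt.isSymmSndFDerivAt (by simp)).eq v w

/-- A Schwartz function times a bounded continuous function is integrable. -/
theorem SchwartzMap.integrable_mul_bounded (f : 𝓢(ℝ × ℝ, ℝ)) {g : ℝ × ℝ → ℝ}
    (hg : Continuous g) {C : ℝ} (hC : ∀ q, |g q| ≤ C) :
    Integrable (fun q => f q * g q) :=
  f.integrable.mul_bdd (c := C) hg.aestronglyMeasurable (.of_forall hC)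

theorem SchwartzMap.exists_abs_le (f : 𝓢(ℝ × ℝ, ℝ)) : ∃ C, ∀ q, |f q| ≤ C :=
  ⟨_, fun q => f.norm_le_seminorm ℝ q⟩

theorem SchwartzMap.integrable_mul_schwartz (f g : 𝓢(ℝ × ℝ, ℝ)) :
    Integrable (fun q => f q * g q) :=
  f.integrable_mul_bounded g.continuous g.exists_abs_le.choose_spec

/-- Integration by parts in `x` of a Schwartz function against a bounded `C¹` function
with bounded `x`-derivative. -/
theorem SchwartzMap.integral_mul_pdx (f : 𝓢(ℝ × ℝ, ℝ)) {g : ℝ × ℝ → ℝ}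
    (hg : ContDiff ℝ 1 g) {C D : ℝ} (hC : ∀ q, |g q| ≤ C) (hD : ∀ q, |pdx g q| ≤ D) :
    ∫ q, f q * pdx g q = - ∫ q, pdx f q * g q := by
  have hgd : Differentiable ℝ g := hg.differentiable (by norm_num)
  have hpg : pdx g = fun q => fderiv ℝ g q (1, 0) := funext (pdx_eq_fderiv hgd)
  have hpf : pdx f = fun q => fderiv ℝ f q (1, 0) := funext (pdx_eq_fderiv f.differentiable)
  have hcont : Continuous (pdx g) := by
    rw [hpg]
    exact (hg.continuous_fderiv (by norm_num)).clm_apply continuous_const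
  have h1 := f.integrable_mul_bounded hcont hD
  have h2 := f.integrable_mul_bounded hg.continuous hC
  have h3 := (∂_{((1, 0) : ℝ × ℝ)} f).integrable_mul_bounded hg.continuous hC
  rw [← pdx_schwartz] at h3
  rw [hpg] at h1 ⊢
  rw [hpf] at h3 ⊢
  exact integral_mul_fderiv_eq_neg_fderiv_mul_of_integrable h3 h1 h2
    (fun q _ => f.differentiable q) (fun q _ => hgd q)

/-- The dispersive terms are skew-symmetric. -/
theorem integral_mul_dispersion_x (f : 𝓢(ℝ × ℝ, ℝ)) :
    ∫ q, f q * pdx (pdx (pdx f)) q = 0 := by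
  simp only [pdx_schwartz]
  set e : ℝ × ℝ := (1, 0)
  have h1 := integral_mul_lineDerivOp_right_eq_neg_left (μ := volume) f (∂_{e} (∂_{e} f)) e
  have h2 := integral_mul_lineDerivOp_right_eq_neg_left (μ := volume) (∂_{e} f) (∂_{e} f) e
  simp only [mul_comm ((∂_{e} (∂_{e} f)) _)] at h2
  linarith

theorem integral_mul_dispersion_y (f : 𝓢(ℝ × ℝ, ℝ)) :
    ∫ q, f q * pdx (pdy (pdy f)) q = 0 := by
  simp only [pdx_schwartz, pdy_schwartz]
  set e : ℝ × ℝ := (1, 0)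
  set n : ℝ × ℝ := (0, 1)
  have h1 := integral_mul_lineDerivOp_right_eq_neg_left (μ := volume) f (∂_{n} (∂_{n} f)) e
  have h2 := integral_mul_lineDerivOp_right_eq_neg_left (μ := volume) (∂_{e} f) (∂_{n} f) n
  have h3 := integral_mul_lineDerivOp_right_eq_neg_left (μ := volume) (∂_{n} f) (∂_{n} f) e
  rw [lineDerivOp_comm_schwartz f n e] at h2
  simp only [mul_comm ((∂_{e} (∂_{n} f)) _)] at h2 h3
  linarith

theorem integral_mul_self_mul_pdx (f : 𝓢(ℝ × ℝ, ℝ)) :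
    ∫ q, f q * pdx (fun q' => f q' ^ 2) q = 0 := by
  obtain ⟨C, hC⟩ := f.exists_abs_le
  obtain ⟨D, hD⟩ := (∂_{((1, 0) : ℝ × ℝ)} f).exists_abs_le
  rw [← pdx_schwartz] at hD
  have hp : ∀ q, pdx (fun q' => f q' ^ 2) q = 2 * (f q * pdx f q) := by
    intro q
    simp only [sq]
    rw [pdx_mul f.differentiable f.differentiable]
    ring
  have h := f.integral_mul_pdx (g := fun q => f q ^ 2) ((f.smooth 1).pow 2) (C := C ^ 2)
    (D := 2 * (C * D)) (fun q => by rw [abs_pow]; gcongr; exact hC q)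
    (fun q => by
      rw [hp, abs_mul, abs_mul, abs_two]
      have := (abs_nonneg _).trans (hC q)
      gcongr
      · exact hC q
      · exact hD q)
  have h2 : ∫ q, f q * pdx (fun q' => f q' ^ 2) q = 2 * ∫ q, pdx f q * f q ^ 2 := by
    rw [← integral_const_mul]
    congr 1 with q
    rw [hp]
    ring
  linarith

section Transport

variable {Ψ : ℝ × ℝ → ℝ} {B Bx : ℝ}

theorem integrable_mul_pdx_mul (f : 𝓢(ℝ × ℝ, ℝ)) (hΨ : ContDiff ℝ 1 Ψ)
    (hB : ∀ q, |Ψ q| ≤ B) (hBx : ∀ q, |pdx Ψ q| ≤ Bx) :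
    Continuous (pdx Ψ) ∧ Integrable (fun q => f q * (pdx f q * Ψ q)) ∧
      Integrable (fun q => f q ^ 2 * pdx Ψ q) := by
  have hd : Differentiable ℝ Ψ := hΨ.differentiable (by norm_num)
  have hcont : Continuous (pdx Ψ) := by
    rw [show pdx Ψ = fun q => fderiv ℝ Ψ q (1, 0) from funext (pdx_eq_fderiv hd)]
    exact (hΨ.continuous_fderiv (by norm_num)).clm_apply continuous_const
  refine ⟨hcont, ?_, ?_⟩
  · have := (f.integrable_mul_schwartz (∂_{((1, 0) : ℝ × ℝ)} f)).mul_bdd (c := B)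
      hΨ.continuous.aestronglyMeasurable (.of_forall hB)
    simpa [pdx_schwartz, mul_assoc] using this
  · have := (f.integrable_mul_schwartz f).mul_bdd (c := Bx)
      hcont.aestronglyMeasurable (.of_forall hBx)
    simpa [sq] using this

/-- The transport term: `∫ u ∂ₓ(uΨ) = ½ ∫ u² ∂ₓΨ`. -/
theorem integral_mul_pdx_mul (f : 𝓢(ℝ × ℝ, ℝ)) (hΨ : ContDiff ℝ 1 Ψ)
    (hB : ∀ q, |Ψ q| ≤ B) (hBx : ∀ q, |pdx Ψ q| ≤ Bx) :
    ∫ q, f q * pdx (fun q' => f q' * Ψ q') q = (1 / 2) * ∫ q, f q ^ 2 * pdx Ψ q := by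
  have hd : Differentiable ℝ Ψ := hΨ.differentiable (by norm_num)
  obtain ⟨-, hi1, hi2⟩ := integrable_mul_pdx_mul f hΨ hB hBx
  obtain ⟨C, hC⟩ := f.exists_abs_le
  obtain ⟨D, hD⟩ := (∂_{((1, 0) : ℝ × ℝ)} f).exists_abs_le
  rw [← pdx_schwartz] at hD
  have hp := pdx_mul f.differentiable hd
  have h := f.integral_mul_pdx (g := fun q => f q * Ψ q) ((f.smooth 1).mul hΨ) (C := C * B)
    (D := D * B + C * Bx)
    (fun q => by
      rw [abs_mul]
      have := (abs_nonneg _).trans (hC q)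
      gcongr
      · exact hC q
      · exact hB q)
    (fun q => by
      rw [hp]
      refine (abs_add_le _ _).trans ?_
      rw [abs_mul, abs_mul]
      have := (abs_nonneg _).trans (hC q)
      have := (abs_nonneg _).trans (hD q)
      gcongr
      · exact hD q
      · exact hB q
      · exact hC q
      · exact hBx q)
  have h2 : ∫ q, f q * pdx (fun q' => f q' * Ψ q') q =
      (∫ q, f q * (pdx f q * Ψ q)) + ∫ q, f q ^ 2 * pdx Ψ q := by
    rw [← integral_add hi1 hi2]
    congr 1 with q
    rw [hp]
    ring
  have h3 : ∫ q, pdx f q * (f q * Ψ q) = ∫ q, f q * (pdx f q * Ψ q) := by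
    congr 1 with q
    ring
  linarith

end Transport

theorem inner_toLp_eq_integral {f g : ℝ × ℝ → ℝ} (hf : MemLp f 2) (hg : MemLp g 2) :
    inner ℝ (hf.toLp f) (hg.toLp g) = ∫ q, f q * g q := by
  rw [L2.inner_def]
  refine integral_congr_ae ?_
  filter_upwards [hf.coeFn_toLp, hg.coeFn_toLp] with q h1 h2
  rw [h1, h2]
  simp [mul_comm]

theorem toReal_eLpNorm_sq {f : ℝ × ℝ → ℝ} (hf : MemLp f 2) :
    (eLpNorm f 2 volume).toReal ^ 2 = ∫ q, f q ^ 2 := by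
  rw [← Lp.norm_toLp f hf, ← real_inner_self_eq_norm_sq, inner_toLp_eq_integral]
  simp [sq]

/-- The energy estimate at a fixed time. -/
theorem energy_inequality (u u' : 𝓢(ℝ × ℝ, ℝ)) {Ψ G : ℝ × ℝ → ℝ} {A B Bx : ℝ}
    (hΨ : ContDiff ℝ 1 Ψ) (hB : ∀ q, |Ψ q| ≤ B) (hBx : ∀ q, |pdx Ψ q| ≤ Bx)
    (hA : eLpNorm G 2 volume ≤ ENNReal.ofReal A)
    (heq : ∀ q, u' q + pdx (pdx (pdx u)) q + pdx (pdy (pdy u)) q +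
      (1 / 2) * pdx (fun q' => u q' ^ 2) q + pdx (fun q' => u q' * Ψ q') q + G q = 0) :
    2 * ∫ q, u q * u' q ≤ (1 + Bx) * (∫ q, u q ^ 2) + A ^ 2 := by
  have hd : Differentiable ℝ Ψ := hΨ.differentiable (by norm_num)
  obtain ⟨hcont, hi1, hi2⟩ := integrable_mul_pdx_mul u hΨ hB hBx
  have hp2 : ∀ q, pdx (fun q' => u q' ^ 2) q = 2 * (u q * pdx u q) := by
    intro q
    simp only [sq]
    rw [pdx_mul u.differentiable u.differentiable]
    ring
  have hpm := pdx_mul u.differentiable hd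
  have hI1 : Integrable (fun q => u q * u' q) := u.integrable_mul_schwartz u'
  have hI2 : Integrable (fun q => u q * pdx (pdx (pdx u)) q) := by
    simp only [pdx_schwartz]
    exact u.integrable_mul_schwartz _
  have hI3 : Integrable (fun q => u q * pdx (pdy (pdy u)) q) := by
    simp only [pdx_schwartz, pdy_schwartz]
    exact u.integrable_mul_schwartz _
  have hI4 : Integrable (fun q => u q * pdx (fun q' => u q' ^ 2) q) := by
    obtain ⟨C, hC⟩ := u.exists_abs_le
    have := ((u.integrable_mul_schwartz (∂_{((1, 0) : ℝ × ℝ)} u)).mul_bdd (c := C)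
      u.continuous.aestronglyMeasurable (.of_forall hC)).const_mul 2
    refine this.congr (.of_forall fun q => ?_)
    simp only [hp2, pdx_schwartz]
    ring
  have hI5 : Integrable (fun q => u q * pdx (fun q' => u q' * Ψ q') q) := by
    refine (hi1.add hi2).congr (.of_forall fun q => ?_)
    simp only [hpm, Pi.add_apply]
    ring
  have hGc : Continuous G := by
    have : G = fun q => -(u' q + pdx (pdx (pdx u)) q + pdx (pdy (pdy u)) q +
        (1 / 2) * (2 * (u q * pdx u q)) + (pdx u q * Ψ q + u q * pdx Ψ q)) := by
      funext q
      have := heq q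
      rw [hp2, hpm] at this
      linarith
    rw [this]
    simp only [pdx_schwartz, pdy_schwartz]
    have := hΨ.continuous
    fun_prop
  have hG : MemLp G 2 := ⟨hGc.aestronglyMeasurable, hA.trans_lt ENNReal.ofReal_lt_top⟩
  have hu : MemLp u 2 := u.memLp 2
  have hGA : ∫ q, G q ^ 2 ≤ A ^ 2 := by
    rw [← toReal_eLpNorm_sq hG]
    have h := ENNReal.toReal_mono ENNReal.ofReal_ne_top hA
    rw [ENNReal.toReal_ofReal'] at h
    refine sq_le_sq.2 ?_
    rw [abs_of_nonneg ENNReal.toReal_nonneg]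
    exact h.trans (max_le (le_abs_self A) (abs_nonneg A))
  have hIu := hu.integrable_sq
  have hIG := hG.integrable_sq
  have hIuG : Integrable (fun q => u q * G q) := hu.integrable_mul hG
  have hsum : (∫ q, u q * u' q) + (1 / 2) * (∫ q, u q ^ 2 * pdx Ψ q) + ∫ q, u q * G q = 0 := by
    have h0 : ∫ q, (u q * u' q + u q * pdx (pdx (pdx u)) q + u q * pdx (pdy (pdy u)) q +
        (1 / 2) * (u q * pdx (fun q' => u q' ^ 2) q) + u q * pdx (fun q' => u q' * Ψ q') q +
        u q * G q) = 0 := by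
      rw [← integral_zero (ℝ × ℝ) ℝ]
      congr 1 with q
      linear_combination u q * heq q
    rw [integral_add (by fun_prop) hIuG, integral_add (by fun_prop) hI5,
      integral_add (by fun_prop) (by fun_prop), integral_add (by fun_prop) hI3,
      integral_add hI1 hI2, integral_const_mul, integral_mul_dispersion_x,
      integral_mul_dispersion_y, integral_mul_self_mul_pdx,
      integral_mul_pdx_mul u hΨ hB hBx] at h0
    linarith
  have hT : -∫ q, u q ^ 2 * pdx Ψ q ≤ Bx * ∫ q, u q ^ 2 := by
    rw [← integral_neg, ← integral_const_mul]
    refine integral_mono hi2.neg (hIu.const_mul _) fun q => ?_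
    have := (abs_le.1 (hBx q)).1
    simp only
    nlinarith [sq_nonneg (u q)]
  have hY : -(2 * ∫ q, u q * G q) ≤ (∫ q, u q ^ 2) + ∫ q, G q ^ 2 := by
    rw [← integral_add hIu hIG, ← integral_const_mul, ← integral_neg]
    refine integral_mono (hIuG.const_mul 2).neg (hIu.add hIG) fun q => ?_
    simp only
    nlinarith [sq_nonneg (u q + G q)]
  linarith

theorem gronwallBound_le_add_mul_mul_exp {δ K ε t : ℝ} (hK : 0 < K) (hε : 0 ≤ ε) :
    gronwallBound δ K ε t ≤ (δ + t * ε) * Real.exp (K * t) := by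
  rw [gronwallBound_of_K_ne_0 hK.ne']
  have h1 : Real.exp (K * t) - 1 ≤ K * t * Real.exp (K * t) := by
    have h2 := Real.add_one_le_exp (-(K * t))
    have h3 : Real.exp (-(K * t)) * Real.exp (K * t) = 1 := by
      rw [← Real.exp_add]
      simp
    nlinarith [Real.exp_pos (K * t)]
  have h4 : ε / K * (Real.exp (K * t) - 1) ≤ ε / K * (K * t * Real.exp (K * t)) := by
    gcongr
  have h5 : ε / K * (K * t * Real.exp (K * t)) = t * ε * Real.exp (K * t) := by
    field_simp
  simp only
  linarith

theorem stmt14 :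
    ∀ T : ℝ, 0 < T →
    ∀ u u' : ℝ → SchwartzMap (ℝ × ℝ) ℝ,
      -- `t ↦ u(t)` is differentiable from `[0,T]` into the Schwartz space,
      -- with derivative `u'`
      (∀ t ∈ Set.Icc (0 : ℝ) T,
        Filter.Tendsto (fun s => (s - t)⁻¹ • (u s - u t))
          (nhdsWithin t (Set.Icc (0 : ℝ) T \ {t})) (nhds (u' t))) →
      -- and the derivative is continuous on `[0,T]`
      ContinuousOn u' (Set.Icc (0 : ℝ) T) →
    ∀ Ψ : ℝ × (ℝ × ℝ) → ℝ, ContDiff ℝ (⊤ : ℕ∞) Ψ →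
      -- Ψ is bounded
      (∃ B : ℝ, ∀ z, |Ψ z| ≤ B) →
      -- ∂ₓΨ is bounded by Bx
      ∀ Bx : ℝ, (∀ z : ℝ × (ℝ × ℝ), |pdx (fun q => Ψ (z.1, q)) z.2| ≤ Bx) →
      -- A bounds sup_{t∈[0,T]} ‖G(t,·)‖_{L²}
      ∀ A : ℝ, (∀ t ∈ Set.Icc (0 : ℝ) T,
        eLpNorm (bgG Ψ t) 2 volume ≤ ENNReal.ofReal A) →
      -- the Zakharov–Kuznetsov equation on the background Ψ
      (∀ t ∈ Set.Icc (0 : ℝ) T, ∀ q : ℝ × ℝ,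
        u' t q + pdx (pdx (pdx ⇑(u t))) q + pdx (pdy (pdy ⇑(u t))) q +
            (1 / 2) * pdx (fun q' => u t q' ^ 2) q +
            pdx (fun q' => u t q' * Ψ (t, q')) q + bgG Ψ t q = 0) →
    ∀ t ∈ Set.Icc (0 : ℝ) T,
      (eLpNorm (⇑(u t)) 2 volume).toReal ^ 2 ≤
        ((eLpNorm (⇑(u 0)) 2 volume).toReal ^ 2 + t * A ^ 2) *
          Real.exp ((1 + Bx) * t) := by
  intro T hT u u' hder _ Ψ hΨ hB Bx hBx A hA heq t ht
  obtain ⟨B, hB⟩ := hB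
  have hBx0 : 0 ≤ Bx := (abs_nonneg _).trans (hBx (0, 0))
  let L := toLpCLM ℝ ℝ 2 (volume : Measure (ℝ × ℝ))
  have hL : ∀ s ∈ Set.Icc (0 : ℝ) T,
      HasDerivWithinAt (fun s => L (u s)) (L (u' s)) (Set.Icc (0 : ℝ) T) s := by
    intro s hs
    rw [hasDerivWithinAt_iff_tendsto_slope]
    refine ((L.continuous.tendsto _).comp (hder s hs)).congr fun r => ?_
    simp [slope_def_module]
  have hE : ∀ s, (∫ q, u s q ^ 2) = ‖L (u s)‖ ^ 2 := by
    intro s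
    rw [← toReal_eLpNorm_sq ((u s).memLp 2)]
    exact congrArg (· ^ 2) norm_toLp.symm
  have hE' : ∀ s ∈ Set.Icc (0 : ℝ) T, HasDerivWithinAt (fun s => ∫ q, u s q ^ 2)
      (2 * ∫ q, u s q * u' s q) (Set.Icc (0 : ℝ) T) s := by
    intro s hs
    simp only [hE]
    rw [← inner_toLp_eq_integral ((u s).memLp 2) ((u' s).memLp 2)]
    exact (hL s hs).norm_sq
  have hbound : ∀ s ∈ Set.Icc (0 : ℝ) T,
      2 * ∫ q, u s q * u' s q ≤ (1 + Bx) * (∫ q, u s q ^ 2) + A ^ 2 := by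
    intro s hs
    refine energy_inequality (u s) (u' s) (Ψ := fun q => Ψ (s, q)) ?_ (fun q => hB (s, q))
      (fun q => hBx (s, q)) (hA s hs) (heq s hs)
    exact (hΨ.of_le (by exact_mod_cast le_top)).comp (contDiff_const.prodMk contDiff_id)
  have hmain := le_gronwallBound_of_liminf_deriv_right_le (a := 0) (b := T)
    (f := fun s => ∫ q, u s q ^ 2) (f' := fun s => 2 * ∫ q, u s q * u' s q)
    (fun s hs => (hE' s hs).continuousWithinAt)
    (fun s hs r hr => by
      have h := (hE' s ⟨hs.1, hs.2.le⟩).mono_of_mem_nhdsWithin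
        (Icc_mem_nhdsGE_of_mem hs)
      exact h.liminf_right_slope_le hr)
    le_rfl (fun s hs => hbound s ⟨hs.1, hs.2.le⟩) t ht
  rw [sub_zero] at hmain
  rw [toReal_eLpNorm_sq ((u t).memLp 2), toReal_eLpNorm_sq ((u 0).memLp 2)]
  exact hmain.trans (gronwallBound_le_add_mul_mul_exp (by linarith) (sq_nonneg A))
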